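/- arXiv:0903.3465 — 2 statements merged into one kernel-verified Lean document; each statement's English description precedes it below -/
import Mathlib

section
/- Let P = (p_{xy}) be a row-stochastic matrix on a finite state space E and π a probability distribution on E satisfying the reversibility condition π_x p_{xy} = π_y p_{yx} for all x,y. Define φ_x = ∑_{y∈E} √(p_{xy}) e_y, Π_A = ∑_{x∈E} |e_x⟩⟨e_x| ⊗ |φ_x⟩⟨φ_x|, Ref_A = 2Π_A − I, the swap S(e_x ⊗ e_y) = e_y ⊗ e_x, Ref_B = S · Ref_A · S, and the quantum walk operator W = Ref_B · Ref_A. Then the state ψ_π = ∑_{x,y∈E} √(π_x p_{xy}) · e_x ⊗ e_y is an eigenvector of W with eigenvalue 1: W ψ_π = ψ_π. -/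
/-- For a reversible pair `(P, π)`, the state
`ψ_π = ∑_{x,y} √(π_x p_{xy}) e_x ⊗ e_y` is an eigenvector with eigenvalue 1 of the
quantum walk operator `W = Ref_B · Ref_A`, where `Ref_A = 2Π_A − I`, `Ref_B = S Ref_A S`,
and `S` is the swap operator. -/
theorem psi_pi_eigenvector_of_walk {E : Type*} [Fintype E] [Nonempty E] [DecidableEq E]
    (P : E → E → ℝ) (pr : E → ℝ)
    (hP_nonneg : ∀ x y, 0 ≤ P x y)
    (hP_row : ∀ x, ∑ y, P x y = 1)
    (hpr_nonneg : ∀ x, 0 ≤ pr x)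
    (hpr_sum : ∑ x, pr x = 1)
    (hrev : ∀ x y, pr x * P x y = pr y * P y x)
    (PiA RefA RefB S W : Matrix (E × E) (E × E) ℂ)
    (hPiA : ∀ p q, PiA p q =
      if p.1 = q.1 then ((Real.sqrt (P p.1 p.2) * Real.sqrt (P p.1 q.2) : ℝ) : ℂ) else 0)
    (hRefA : RefA = (2 : ℂ) • PiA - 1)
    (hS : ∀ p q, S p q = if p.1 = q.2 ∧ p.2 = q.1 then 1 else 0)
    (hRefB : RefB = S * RefA * S)
    (hW : W = RefB * RefA)
    (ψ : (E × E) → ℂ)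
    (hψ : ∀ p, ψ p = ((Real.sqrt (pr p.1 * P p.1 p.2) : ℝ) : ℂ)) :
    W.mulVec ψ = ψ := by
  have hPi : PiA.mulVec ψ = ψ := by
    ext ⟨x, y⟩
    have hsum : ∑ z, Real.sqrt (P x y) * Real.sqrt (P x z) * Real.sqrt (pr x * P x z) =
        Real.sqrt (pr x * P x y) := by
      calc
        _ = ∑ z, Real.sqrt (pr x) * Real.sqrt (P x y) * P x z := by
          refine Finset.sum_congr rfl fun z _ => ?_
          rw [Real.sqrt_mul (hpr_nonneg x)]
          linear_combination Real.sqrt (pr x) * Real.sqrt (P x y) *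
            Real.mul_self_sqrt (hP_nonneg x z)
        _ = _ := by
          rw [← Finset.mul_sum, hP_row, mul_one, Real.sqrt_mul (hpr_nonneg x)]
    simp only [Matrix.mulVec, dotProduct, hPiA, hψ, Fintype.sum_prod_type, ite_mul, zero_mul]
    rw [Finset.sum_comm]
    simp only [Finset.sum_ite_eq, Finset.mem_univ, if_true]
    exact_mod_cast hsum
  have hA : RefA.mulVec ψ = ψ := by
    rw [hRefA, Matrix.sub_mulVec, Matrix.smul_mulVec, hPi, Matrix.one_mulVec, two_smul,
      add_sub_cancel_right]
  have hSψ : S.mulVec ψ = ψ := by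
    ext ⟨x, y⟩
    simp only [Matrix.mulVec, dotProduct, hS, hψ, Fintype.sum_prod_type, ite_mul, zero_mul,
      one_mul, ite_and]
    rw [Finset.sum_comm]
    simp [hrev y x]
  rw [hW, hRefB, ← Matrix.mulVec_mulVec, hA, ← Matrix.mulVec_mulVec, hSψ,
    ← Matrix.mulVec_mulVec, hA, hSψ]
end

section
/- Let t and n be positive integers, and let a, ã be real numbers with 0 ≤ a ≤ √(1 − 2^{−t}), 0 ≤ ã ≤ √(1 − 2^{−t}), and |ã − a| ≤ 2^{−n}. Then |arccos ã − arccos a| ≤ 2^{−n + t/2}. (Error bound on the rotation angles computed with n-bit precision from t-bit transition probabilities.) -/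
/-- On `[0, √(1 - c)]` with `0 < c ≤ 1`, `arccos` is Lipschitz with constant `1 / √c`. -/
theorem abs_arccos_sub_arccos_le {c x y : ℝ} (hc : 0 < c) (hc1 : c ≤ 1)
    (hx : x ∈ Set.Icc 0 √(1 - c)) (hy : y ∈ Set.Icc 0 √(1 - c)) :
    |Real.arccos y - Real.arccos x| ≤ 1 / √c * |y - x| := by
  have le_one_sub_sq : ∀ z ∈ Set.Icc 0 √(1 - c), c ≤ 1 - z ^ 2 := fun z hz => by
    have := (Real.le_sqrt hz.1 (by linarith)).1 hz.2
    linarith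
  refine (convex_Icc 0 √(1 - c)).norm_image_sub_le_of_norm_hasDerivWithin_le
    (f := Real.arccos) (f' := fun z => -(1 / √(1 - z ^ 2))) (fun z hz => ?_)
    (fun z hz => ?_) hx hy
  · have h := le_one_sub_sq z hz
    exact (Real.hasDerivAt_arccos (by rintro rfl; norm_num at h; linarith)
      (by rintro rfl; norm_num at h; linarith)).hasDerivWithinAt
  · rw [norm_neg, Real.norm_of_nonneg (by positivity)]
    exact one_div_le_one_div_of_le (Real.sqrt_pos.2 hc)
      (Real.sqrt_le_sqrt (le_one_sub_sq z hz))

/-- Error bound on the rotation angles: if `a, ã ∈ [0, √(1 − 2^{−t})]`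
and `|ã − a| ≤ 2^{−n}`, then `|arccos ã − arccos a| ≤ 2^{−n + t/2}`. -/
theorem angle_error_bound (t n : ℕ) (ht : 1 ≤ t) (hn : 1 ≤ n) (a a' : ℝ)
    (ha0 : 0 ≤ a) (ha1 : a ≤ Real.sqrt (1 - (2 : ℝ) ^ (-(t : ℤ))))
    (ha'0 : 0 ≤ a') (ha'1 : a' ≤ Real.sqrt (1 - (2 : ℝ) ^ (-(t : ℤ))))
    (hdiff : |a' - a| ≤ (2 : ℝ) ^ (-(n : ℤ))) :
    |Real.arccos a' - Real.arccos a| ≤ (2 : ℝ) ^ (-(n : ℝ) + (t : ℝ) / 2) := by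
  have hc1 : (2 : ℝ) ^ (-(t : ℤ)) ≤ 1 := zpow_le_one_of_nonpos₀ (by norm_num) (by simp)
  have hsqrt : 1 / √((2 : ℝ) ^ (-(t : ℤ))) = (2 : ℝ) ^ ((t : ℝ) / 2) := by
    rw [← Real.rpow_intCast, Real.sqrt_eq_rpow, ← Real.rpow_mul (by norm_num), one_div,
      ← Real.rpow_neg (by norm_num)]
    congr 1
    push_cast
    ring
  have hpow : (2 : ℝ) ^ (-(n : ℤ)) = (2 : ℝ) ^ (-(n : ℝ)) := by
    rw [← Real.rpow_intCast]
    push_cast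
    rfl
  calc |Real.arccos a' - Real.arccos a|
      ≤ 1 / √((2 : ℝ) ^ (-(t : ℤ))) * |a' - a| :=
        abs_arccos_sub_arccos_le (by positivity) hc1 ⟨ha0, ha1⟩ ⟨ha'0, ha'1⟩
    _ ≤ (2 : ℝ) ^ ((t : ℝ) / 2) * (2 : ℝ) ^ (-(n : ℝ)) := by
        rw [hsqrt, ← hpow]
        gcongr
    _ = (2 : ℝ) ^ (-(n : ℝ) + (t : ℝ) / 2) := by
        rw [← Real.rpow_add (by norm_num), add_comm]
end
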